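/- Every three-qubit unextendible product basis is equivalent (via local unitaries and a permutation of its members) to one of the canonical form |S_1⟩ = |0⟩⊗|0⟩⊗|0⟩, |S_2⟩ = |1⟩⊗|B⟩⊗|C⟩, |S_3⟩ = |A⟩⊗|1⟩⊗|C^⊥⟩, |S_4⟩ = |A^⊥⟩⊗|B^⊥⟩⊗|1⟩, where |A⟩, |B⟩, |C⟩ are unit vectors in ℂ² and |A^⊥⟩, |B^⊥⟩, |C^⊥⟩ denote unit vectors orthogonal to them. -/

import Mathlib

noncomputable section

open Matrix Finset
open scoped ComplexOrder

/-- one-qubit vectors -/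
abbrev V2 := Fin 2 → ℂ
/-- index set of the three-qubit space ℂ²⊗ℂ²⊗ℂ² -/
abbrev I8 := Fin 2 × Fin 2 × Fin 2
/-- three-qubit vectors -/
abbrev V8 := I8 → ℂ
/-- one-qubit operators -/
abbrev M2 := Matrix (Fin 2) (Fin 2) ℂ
/-- three-qubit operators -/
abbrev M8 := Matrix I8 I8 ℂ

/-- inner product on ℂ², conjugate-linear in the first argument -/
def inner2 (u v : V2) : ℂ := ∑ i, star (u i) * v i

/-- inner product on ℂ²⊗ℂ²⊗ℂ², conjugate-linear in the first argument -/
def inner8 (u v : V8) : ℂ := ∑ p, star (u p) * v p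

/-- tensor product |a⟩⊗|b⟩⊗|c⟩ of three one-qubit vectors -/
def tp3 (a b c : V2) : V8 := fun p => a p.1 * b p.2.1 * c p.2.2

/-- Kronecker (tensor) product X_A⊗X_B⊗X_C of three one-qubit operators -/
def kron3 (X Y Z : M2) : M8 :=
  Matrix.of fun p q => X p.1 q.1 * Y p.2.1 q.2.1 * Z p.2.2 q.2.2

/-- a product operator on three qubits -/
def IsProductOp (X : M8) : Prop := ∃ XA XB XC : M2, X = kron3 XA XB XC

/-- the projector |v⟩⟨v| onto a vector -/
def proj8 (v : V8) : M8 := Matrix.vecMulVec v (star v)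

/-- A three-qubit unextendible product basis with `n` members: mutually orthonormal
product vectors (products of unit vectors) such that the orthogonal complement of
their span contains no nonzero product vector. -/
structure UPB (n : ℕ) where
  S : Fin n → V8
  prod : ∀ j, ∃ a b c : V2,
    inner2 a a = 1 ∧ inner2 b b = 1 ∧ inner2 c c = 1 ∧ S j = tp3 a b c
  ortho : ∀ i j, inner8 (S i) (S j) = if i = j then 1 else 0
  unext : ∀ a b c : V2, (∀ j, inner8 (S j) (tp3 a b c) = 0) → tp3 a b c = 0

/-- the bound entangled state ρ_S = (1/(8-n))(I - Σ_j |S_j⟩⟨S_j|) associated with a UPB -/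
def upbState {n : ℕ} (U : UPB n) : M8 :=
  ((8 : ℂ) - (n : ℂ))⁻¹ • ((1 : M8) - ∑ j, proj8 (U.S j))

/-- equivalence of four-member UPBs: related by local unitaries and a permutation of members -/
def UPB.Equiv (S T : UPB 4) : Prop :=
  ∃ UA UB UC : M2, UA ∈ Matrix.unitaryGroup (Fin 2) ℂ ∧
    UB ∈ Matrix.unitaryGroup (Fin 2) ℂ ∧ UC ∈ Matrix.unitaryGroup (Fin 2) ℂ ∧
    ∃ σ : Equiv.Perm (Fin 4), ∀ j, S.S j = (kron3 UA UB UC).mulVec (T.S (σ j))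

/-- The positive semidefinite square root of a positive semidefinite matrix
(the definition of the older Mathlib, since removed) -/
def Matrix.PosSemidef.sqrt {n 𝕜 : Type*} [Fintype n] [RCLike 𝕜] [DecidableEq n]
    {A : Matrix n n 𝕜} (hA : A.PosSemidef) : Matrix n n 𝕜 :=
  hA.1.eigenvectorUnitary.1 * diagonal ((↑) ∘ Real.sqrt ∘ hA.1.eigenvalues) *
    (star hA.1.eigenvectorUnitary : Matrix n n 𝕜)

/-- square root of a positive semidefinite matrix (junk value 0 otherwise) -/
def msqrt {m : Type*} [Fintype m] [DecidableEq m] (A : Matrix m m ℂ) : Matrix m m ℂ :=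
  open scoped Classical in if h : A.PosSemidef then h.sqrt else 0

/-- fidelity F(ρ,σ) = tr √(√ρ σ √ρ) of positive semidefinite matrices -/
def fidelity {m : Type*} [Fintype m] [DecidableEq m] (ρ σ : Matrix m m ℂ) : ℝ :=
  ((msqrt (msqrt ρ * σ * msqrt ρ)).trace).re

/-- standard basis vector |0⟩ of ℂ² -/
def e0 : V2 := ![1, 0]
/-- standard basis vector |1⟩ of ℂ² -/
def e1 : V2 := ![0, 1]

lemma inner2_symm_zero {u v : V2} (h : inner2 u v = 0) : inner2 v u = 0 := by
  have := congrArg star h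
  simpa [inner2, Fin.sum_univ_two, mul_comm] using this

lemma inner8_tp3 (a b c x y z : V2) :
    inner8 (tp3 a b c) (tp3 x y z) = inner2 a x * inner2 b y * inner2 c z := by
  simp only [inner8, inner2, tp3, Fintype.sum_prod_type, Fin.sum_univ_two, star_mul']
  ring

lemma kron3_mulVec_tp3 (X Y Z : M2) (a b c : V2) :
    (kron3 X Y Z).mulVec (tp3 a b c) = tp3 (X *ᵥ a) (Y *ᵥ b) (Z *ᵥ c) := by
  ext p
  simp only [kron3, tp3, mulVec, dotProduct, of_apply, Fintype.sum_prod_type, Fin.sum_univ_two]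
  ring

lemma tp3_ne_zero {a b c : V2} (ha : a ≠ 0) (hb : b ≠ 0) (hc : c ≠ 0) : tp3 a b c ≠ 0 := by
  obtain ⟨i, hi⟩ := Function.ne_iff.1 ha
  obtain ⟨j, hj⟩ := Function.ne_iff.1 hb
  obtain ⟨k, hk⟩ := Function.ne_iff.1 hc
  exact Function.ne_iff.2 ⟨(i, j, k), mul_ne_zero (mul_ne_zero hi hj) hk⟩

lemma ne_zero_of_inner2_self {u : V2} (h : inner2 u u = 1) : u ≠ 0 := by
  rintro rfl
  simp [inner2] at h

lemma exists_ne_zero_inner2_eq_zero {u : V2} (h : u ≠ 0) : ∃ w : V2, w ≠ 0 ∧ inner2 u w = 0 := by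
  refine ⟨![-star (u 1), star (u 0)], fun hw => h ?_, ?_⟩
  · have h0 := congrFun hw 0
    have h1 := congrFun hw 1
    ext i
    fin_cases i <;> simp_all
  · simp [inner2, Fin.sum_univ_two]
    ring

/-- An orthonormal pair in ℂ² is the image of the standard basis under a unitary. -/
lemma exists_unitary_of_orthonormal {u w : V2} (hu : inner2 u u = 1) (hw : inner2 w w = 1)
    (h : inner2 u w = 0) :
    ∃ U ∈ Matrix.unitaryGroup (Fin 2) ℂ, U *ᵥ e0 = u ∧ U *ᵥ e1 = w := by
  have h' := inner2_symm_zero h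
  refine ⟨!![u 0, w 0; u 1, w 1], ?_, ?_, ?_⟩
  · rw [Matrix.mem_unitaryGroup_iff']
    simp only [inner2, Fin.sum_univ_two] at hu hw h h'
    ext i j
    fin_cases i <;> fin_cases j <;>
      simpa [Matrix.mul_apply, Fin.sum_univ_two, Matrix.star_apply]
  · ext i
    fin_cases i <;> simp [e0, mulVec, dotProduct, Fin.sum_univ_two]
  · ext i
    fin_cases i <;> simp [e1, mulVec, dotProduct, Fin.sum_univ_two]

lemma unitary_mulVec_star_mulVec {U : M2} (hU : U ∈ Matrix.unitaryGroup (Fin 2) ℂ) (u : V2) :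
    U *ᵥ (star U *ᵥ u) = u := by
  rw [mulVec_mulVec, Matrix.mem_unitaryGroup_iff.1 hU, one_mulVec]

lemma inner2_star_unitary {U : M2} (hU : U ∈ Matrix.unitaryGroup (Fin 2) ℂ) (u v : V2) :
    inner2 (star U *ᵥ u) (star U *ᵥ v) = inner2 u v := by
  change star (star U *ᵥ u) ⬝ᵥ (star U *ᵥ v) = star u ⬝ᵥ v
  rw [star_mulVec, ← star_eq_conjTranspose, star_star, ← dotProduct_mulVec,
    unitary_mulVec_star_mulVec hU]

/-- In a local factor of a four-member UPB, no vector is orthogonal to two different members. -/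
lemma UPB.eq_of_inner2_eq_zero (S : UPB 4) {v : Fin 3 → Fin 4 → V2}
    (hv : ∀ p j, inner2 (v p j) (v p j) = 1)
    (hS : ∀ j, S.S j = tp3 (v 0 j) (v 1 j) (v 2 j)) {p : Fin 3} {i k j : Fin 4}
    (hi : inner2 (v p i) (v p j) = 0) (hk : inner2 (v p k) (v p j) = 0) : i = k := by
  by_contra hik
  have hcov : ∀ i k : Fin 4, i ≠ k → ∃ m n : Fin 4, ∀ l, l = i ∨ l = k ∨ l = m ∨ l = n := by
    decide
  obtain ⟨m, n, hmn⟩ := hcov i k hik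
  choose w hw0 hw using fun q l => exists_ne_zero_inner2_eq_zero (ne_zero_of_inner2_self (hv q l))
  let x : Fin 3 → V2 := fun q => if q = p then v p j else if q = p + 1 then w q m else w q n
  have hx0 : ∀ q, x q ≠ 0 := fun q => by
    dsimp only [x]
    split_ifs
    exacts [ne_zero_of_inner2_self (hv p j), hw0 q m, hw0 q n]
  refine tp3_ne_zero (hx0 0) (hx0 1) (hx0 2) (S.unext _ _ _ fun l => ?_)
  suffices ∃ q, inner2 (v q l) (x q) = 0 by
    rw [hS, inner8_tp3]
    obtain ⟨q, hq⟩ := this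
    fin_cases q <;> simp_all
  rcases hmn l with rfl | rfl | rfl | rfl
  · exact ⟨p, by simpa [x] using hi⟩
  · exact ⟨p, by simpa [x] using hk⟩
  · exact ⟨p + 1, by simpa [x] using hw (p + 1) l⟩
  · refine ⟨p + 2, ?_⟩
    have hp : ∀ p : Fin 3, p + 2 ≠ p ∧ p + 2 ≠ p + 1 := by decide
    obtain ⟨h1, h2⟩ := hp p
    simpa only [x, if_neg h1, if_neg h2] using hw (p + 2) l

/-- The members of a four-member UPB can be ordered so that member `0` is orthogonal to
member `p + 1` in the factor `p`, and the remaining two members are orthogonal there. -/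
lemma UPB.exists_perm_inner2_eq_zero (S : UPB 4) {v : Fin 3 → Fin 4 → V2}
    (hv : ∀ p j, inner2 (v p j) (v p j) = 1)
    (hS : ∀ j, S.S j = tp3 (v 0 j) (v 1 j) (v 2 j)) :
    ∃ τ : Equiv.Perm (Fin 4), (∀ p, inner2 (v p (τ 0)) (v p (τ p.succ)) = 0) ∧
      inner2 (v 0 (τ 2)) (v 0 (τ 3)) = 0 ∧ inner2 (v 1 (τ 1)) (v 1 (τ 3)) = 0 ∧
      inner2 (v 2 (τ 1)) (v 2 (τ 2)) = 0 := by
  have hor : ∀ i j, i ≠ j → ∃ p, inner2 (v p i) (v p j) = 0 := fun i j hij => by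
    have h := S.ortho i j
    rw [if_neg hij, hS, hS, inner8_tp3, mul_eq_zero, mul_eq_zero] at h
    rcases h with (h | h) | h
    exacts [⟨0, h⟩, ⟨1, h⟩, ⟨2, h⟩]
  choose f hf using fun i : Fin 3 => hor 0 i.succ (Fin.succ_ne_zero i).symm
  have hinj : Function.Injective f := fun i k hik => by
    refine Fin.succ_injective _ (S.eq_of_inner2_eq_zero hv hS (inner2_symm_zero (hf i)) ?_)
    exact hik ▸ inner2_symm_zero (hf k)
  let e : Equiv.Perm (Fin 3) := Equiv.ofBijective f (Finite.injective_iff_bijective.1 hinj)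
  let τ : Equiv.Perm (Fin 4) := Equiv.Perm.decomposeFin.symm (0, e.symm)
  have h0 : ∀ p, inner2 (v p (τ 0)) (v p (τ p.succ)) = 0 := fun p => by
    have hp : f (e.symm p) = p := e.apply_symm_apply p
    simpa [τ, hp] using hf (e.symm p)
  have hedge : ∀ p q r : Fin 3, q ≠ r → (∀ s, s ≠ q → s ≠ r → s = p) →
      inner2 (v p (τ q.succ)) (v p (τ r.succ)) = 0 := fun p q r hqr hp => by
    obtain ⟨s, hs⟩ := hor (τ q.succ) (τ r.succ) fun h => hqr (Fin.succ_injective _ (τ.injective h))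
    refine hp s ?_ ?_ ▸ hs
    · rintro rfl
      exact Fin.succ_ne_zero r (τ.injective
        (S.eq_of_inner2_eq_zero hv hS (inner2_symm_zero hs) (h0 s)))
    · rintro rfl
      exact Fin.succ_ne_zero q (τ.injective (S.eq_of_inner2_eq_zero hv hS hs (h0 s)))
  exact ⟨τ, h0, hedge 0 1 2 (by decide) (by decide), hedge 1 0 2 (by decide) (by decide),
    hedge 2 0 1 (by decide) (by decide)⟩

/-- every three-qubit UPB is equivalent (via local unitaries and a
permutation of its members) to one of the canonical form
|000⟩, |1⟩|B⟩|C⟩, |A⟩|1⟩|C⊥⟩, |A⊥⟩|B⊥⟩|1⟩. -/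
theorem stmt2 (S : UPB 4) :
    ∃ A B C Ap Bp Cp : V2,
      inner2 A A = 1 ∧ inner2 B B = 1 ∧ inner2 C C = 1 ∧
      inner2 Ap Ap = 1 ∧ inner2 Bp Bp = 1 ∧ inner2 Cp Cp = 1 ∧
      inner2 A Ap = 0 ∧ inner2 B Bp = 0 ∧ inner2 C Cp = 0 ∧
      ∃ UA UB UC : M2, UA ∈ Matrix.unitaryGroup (Fin 2) ℂ ∧
        UB ∈ Matrix.unitaryGroup (Fin 2) ℂ ∧ UC ∈ Matrix.unitaryGroup (Fin 2) ℂ ∧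
        ∃ σ : Equiv.Perm (Fin 4), ∀ j, S.S j = (kron3 UA UB UC).mulVec
          (![tp3 e0 e0 e0, tp3 e1 B C, tp3 A e1 Cp, tp3 Ap Bp e1] (σ j)) := by
  choose a b c ha hb hc hS using S.prod
  obtain ⟨τ, h0, hA, hB, hC⟩ := S.exists_perm_inner2_eq_zero (v := ![a, b, c])
    (fun p j => by fin_cases p; exacts [ha j, hb j, hc j]) hS
  obtain ⟨UA, hUA, hA0, hA1⟩ := exists_unitary_of_orthonormal (ha _) (ha _) (h0 0)
  obtain ⟨UB, hUB, hB0, hB1⟩ := exists_unitary_of_orthonormal (hb _) (hb _) (h0 1)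
  obtain ⟨UC, hUC, hC0, hC1⟩ := exists_unitary_of_orthonormal (hc _) (hc _) (h0 2)
  refine ⟨star UA *ᵥ a (τ 2), star UB *ᵥ b (τ 1), star UC *ᵥ c (τ 1),
    star UA *ᵥ a (τ 3), star UB *ᵥ b (τ 3), star UC *ᵥ c (τ 2), ?_⟩
  simp only [inner2_star_unitary hUA, inner2_star_unitary hUB, inner2_star_unitary hUC]
  refine ⟨ha _, hb _, hc _, ha _, hb _, hc _, hA, hB, hC, UA, UB, UC, hUA, hUB, hUC, τ.symm, ?_⟩
  refine τ.forall_congr_right.1 fun j => ?_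
  rw [τ.symm_apply_apply, hS]
  fin_cases j <;> refine Eq.trans ?_ (kron3_mulVec_tp3 UA UB UC _ _ _).symm
  · rw [hA0, hB0, hC0]
    rfl
  · rw [hA1, unitary_mulVec_star_mulVec hUB, unitary_mulVec_star_mulVec hUC]
    rfl
  · rw [hB1, unitary_mulVec_star_mulVec hUA, unitary_mulVec_star_mulVec hUC]
    rfl
  · rw [hC1, unitary_mulVec_star_mulVec hUA, unitary_mulVec_star_mulVec hUB]
    rfl
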